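/- There is a universal constant C > 0 such that the following holds. Let (X,d) be a finite metric space admitting a dominating stochastic embedding into tree metrics with expected distortion D ≥ 1, and let s : X → ℝ satisfy s(v) > 0 for all v and |s(v) − s(u)| ≤ d(v,u) for all u,v ∈ X. Then there exists f : X → ℓ1 such that: (1) ‖f(v)‖₁ = s(v) for every v ∈ X; (2) ‖f(v) − f(u)‖₁ ≤ C·D·d(v,u) for all u,v ∈ X; and (3) for every c ≥ 1 and every u,v ∈ X with min{s(v), s(u)} ≥ d(u,v)/c, it holds that ‖f(v) − f(u)‖₁ ≥ d(v,u)/(12c). -/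

import Mathlib

noncomputable section

open scoped BigOperators

/-- The space `ℓ₁` of absolutely summable real sequences. -/
abbrev ℓ1 : Type := lp (fun _ : ℕ => ℝ) 1

/-- The weight of a walk: the sum of the weights of its edges. -/
def walkWeight {V : Type*} {G : SimpleGraph V} (w : V → V → ℝ)
    {u v : V} (p : G.Walk u v) : ℝ :=
  (p.darts.map fun d => w d.toProd.1 d.toProd.2).sum

/-- The shortest-path distance between `u` and `v` in the graph `G`
with edge weights `w`. -/
def wdist {V : Type*} (G : SimpleGraph V) (w : V → V → ℝ) (u v : V) : ℝ :=
  sInf {x | ∃ p : G.Walk u v, walkWeight w p = x}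

/-- A connected weighted graph with positive symmetric edge weights. -/
structure WeightedGraph (V : Type*) where
  G : SimpleGraph V
  conn : G.Connected
  w : V → V → ℝ
  w_symm : ∀ u v, w u v = w v u
  w_pos : ∀ u v, G.Adj u v → 0 < w u v

/-- The shortest-path metric of a weighted graph. -/
def WeightedGraph.dist {V : Type*} (W : WeightedGraph V) (u v : V) : ℝ :=
  wdist W.G W.w u v

/-- `ρ` is a tree metric on `X`: there is a finite weighted tree containing (a copy of)
`X` among its vertices whose shortest-path metric restricts to `ρ` on `X`. -/
def IsTreeMetric {X : Type} (ρ : X → X → ℝ) : Prop :=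
  ∃ (V : Type) (_ : Fintype V) (W : WeightedGraph V), W.G.IsTree ∧
    ∃ j : X → V, Function.Injective j ∧ ∀ u v : X, ρ u v = W.dist (j u) (j v)

/-! ### Walk weights -/

lemma walkWeight_nil' {V : Type*} {G : SimpleGraph V} (w : V → V → ℝ) (u : V) :
    walkWeight w (SimpleGraph.Walk.nil : G.Walk u u) = 0 := by
  simp [walkWeight]

lemma walkWeight_cons' {V : Type*} {G : SimpleGraph V} (w : V → V → ℝ) {u v x : V}
    (h : G.Adj u v) (q : G.Walk v x) :
    walkWeight w (SimpleGraph.Walk.cons h q) = w u v + walkWeight w q := by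
  simp [walkWeight]

lemma walkWeight_append' {V : Type*} {G : SimpleGraph V} (w : V → V → ℝ) {u v x : V}
    (q : G.Walk u v) (q' : G.Walk v x) :
    walkWeight w (q.append q') = walkWeight w q + walkWeight w q' := by
  simp [walkWeight]

lemma walkWeight_reverse' {V : Type*} {G : SimpleGraph V} (w : V → V → ℝ)
    (hw : ∀ u v, w u v = w v u) {u v : V} (q : G.Walk u v) :
    walkWeight w q.reverse = walkWeight w q := by
  induction q with
  | nil => simp [walkWeight]
  | cons h q ih =>
    rw [SimpleGraph.Walk.reverse_cons, walkWeight_append', ih, walkWeight_cons', walkWeight_cons',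
      walkWeight_nil', hw]
    ring

lemma walkWeight_nonneg' {V : Type*} (W : WeightedGraph V) {u v : V} (q : W.G.Walk u v) :
    0 ≤ walkWeight W.w q := by
  induction q with
  | nil => simp [walkWeight]
  | cons h q ih =>
    rw [walkWeight_cons']
    have := W.w_pos _ _ h
    linarith

/-- In a tree, the distance is the weight of the path. -/
lemma dist_eq_of_isPath {V : Type*} (W : WeightedGraph V) (hT : W.G.IsTree) {u v : V}
    (q : W.G.Walk u v) (hq : q.IsPath) : W.dist u v = walkWeight W.w q := by
  classical
  apply IsLeast.csInf_eq
  refine ⟨⟨q, rfl⟩, ?_⟩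
  rintro x ⟨q', rfl⟩
  have h1 : q = q'.bypass := (hT.existsUnique_path u v).unique hq q'.bypass_isPath
  rw [h1]
  unfold walkWeight
  apply List.Sublist.sum_le_sum ((q'.darts_bypass_sublist_darts).map _)
  intro a ha
  obtain ⟨d, _, rfl⟩ := List.mem_map.1 ha
  exact (W.w_pos _ _ d.adj).le

/-- Splitting a walk at its first vertex in a set. -/
lemma exists_first_hit {V : Type*} {G : SimpleGraph V} (S : Set V) {u r : V} (q : G.Walk u r)
    (hr : r ∈ S) : ∃ w ∈ S, ∃ (q1 : G.Walk u w) (q2 : G.Walk w r), q = q1.append q2 ∧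
      ∀ x ∈ q1.support, x ∈ S → x = w := by
  induction q with
  | nil => exact ⟨_, hr, SimpleGraph.Walk.nil, SimpleGraph.Walk.nil, by simp, by simp⟩
  | @cons a b c h q ih =>
    by_cases ha : a ∈ S
    · exact ⟨a, ha, SimpleGraph.Walk.nil, SimpleGraph.Walk.cons h q, by simp, by simp⟩
    · obtain ⟨w, hw, q1, q2, e, hx⟩ := ih hr
      refine ⟨w, hw, SimpleGraph.Walk.cons h q1, q2, by simp [e], ?_⟩
      intro x hx1 hxS
      rw [SimpleGraph.Walk.support_cons, List.mem_cons] at hx1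
      rcases hx1 with rfl | hx1
      · exact absurd hxS ha
      · exact hx x hx1 hxS

/-- Combinatorial data of a rooted tree: sets of ancestors `P`, depths `h`, and edge profiles `g`,
where `g x t` is the length of the part of the edge above `x` lying at depth at least `-t`. -/
lemma tree_data {V : Type} (W : WeightedGraph V) (hT : W.G.IsTree) :
    ∃ (P : V → Finset V) (h : V → ℝ) (g : V → ℝ → ℝ),
      (∀ x t, 0 ≤ g x t) ∧ (∀ x, Monotone (g x)) ∧ (∀ v, 0 ≤ h v) ∧
      (∀ v t, ∑ x ∈ P v, g x t = max (t + h v) 0) ∧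
      (∀ u v, ∃ w, (∀ x, x ∈ P w ↔ x ∈ P u ∧ x ∈ P v) ∧ h w ≤ h u ∧ h w ≤ h v ∧
        W.dist u v = h u + h v - 2 * h w) := by
  classical
  obtain ⟨r⟩ := W.conn.nonempty
  choose pth hpth huniq using fun v => hT.existsUnique_path v r
  simp only at hpth huniq
  have hpar : ∀ x, ∃ y, x ≠ r → ∃ a : W.G.Adj x y, pth x = SimpleGraph.Walk.cons a (pth y) := by
    intro x
    by_cases hx : x = r
    · exact ⟨x, fun h => absurd hx h⟩
    · have key : ∀ q : W.G.Walk x r, q.IsPath →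
          ∃ y, ∃ a : W.G.Adj x y, q = SimpleGraph.Walk.cons a (pth y) := by
        intro q hq
        cases q with
        | nil => exact absurd rfl hx
        | @cons _ y _ a q =>
          refine ⟨y, a, ?_⟩
          rw [huniq y q hq.of_cons]
      obtain ⟨y, hy⟩ := key _ (hpth x)
      exact ⟨y, fun _ => hy⟩
  choose par hpar using hpar
  have hroot : pth r = SimpleGraph.Walk.nil := (huniq r _ SimpleGraph.Walk.IsPath.nil).symm
  set h : V → ℝ := fun v => walkWeight W.w (pth v) with hh
  have hr0 : h r = 0 := by simp only [hh, hroot, walkWeight_nil']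
  have h0 : ∀ v, 0 ≤ h v := fun v => walkWeight_nonneg' W _
  have hle : ∀ x, x ≠ r → h (par x) ≤ h x := by
    intro x hx
    obtain ⟨a, ha⟩ := hpar x hx
    simp only [hh]
    rw [ha, walkWeight_cons']
    have := W.w_pos _ _ a
    linarith
  let g : V → ℝ → ℝ := fun x t =>
    if x = r then max t 0 else max (t + h x) 0 - max (t + h (par x)) 0
  refine ⟨fun v => (pth v).support.toFinset, h, g, ?_, ?_, h0, ?_, ?_⟩
  · intro x t
    by_cases hx : x = r
    · simp [g, hx]
    · simp only [g, hx, if_false, sub_nonneg]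
      exact max_le_max (by linarith [hle x hx]) le_rfl
  · intro x t t' htt
    by_cases hx : x = r
    · simp only [g, hx, if_true]
      exact max_le_max htt le_rfl
    · simp only [g, hx, if_false]
      have := hle x hx
      rcases max_cases (t + h x) 0 with ⟨e1, _⟩ | ⟨e1, _⟩ <;>
      rcases max_cases (t + h (par x)) 0 with ⟨e2, _⟩ | ⟨e2, _⟩ <;>
      rcases max_cases (t' + h x) 0 with ⟨e3, _⟩ | ⟨e3, _⟩ <;>
      rcases max_cases (t' + h (par x)) 0 with ⟨e4, _⟩ | ⟨e4, _⟩ <;>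
      rw [e1, e2, e3, e4] <;> linarith
  · intro v t
    have key : ∀ n v, (pth v).length = n →
        ∑ x ∈ (pth v).support.toFinset, g x t = max (t + h v) 0 := by
      intro n
      induction n with
      | zero =>
        intro v hv
        have hvr := SimpleGraph.Walk.eq_of_length_eq_zero hv
        subst hvr
        rw [hroot, hr0]
        simp [g]
      | succ n ih =>
        intro v hv
        have hvr : v ≠ r := by
          rintro rfl
          rw [hroot] at hv
          simp at hv
        obtain ⟨a, ha⟩ := hpar v hvr
        have hp := hpth v
        rw [ha] at hv hp ⊢
        have h2 := ih (par v) (by simpa using hv)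
        have h3 := ((SimpleGraph.Walk.cons_isPath_iff _ _).1 hp).2
        rw [SimpleGraph.Walk.support_cons, List.toFinset_cons, Finset.sum_insert (by simpa using h3),
          h2]
        simp [g, hvr]
    exact key _ v rfl
  · intro u v
    obtain ⟨w, hw, q1, q2, e, hx⟩ := exists_first_hit {x | x ∈ (pth v).support} (pth u)
      (by simp)
    obtain ⟨a, b, e'⟩ := SimpleGraph.Walk.mem_support_iff_exists_append.1 hw
    have pu := hpth u
    have pv := hpth v
    rw [e] at pu
    rw [e'] at pv
    have hq2 : q2 = pth w := huniq w q2 pu.of_append_right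
    have hb : b = pth w := huniq w b pv.of_append_right
    subst hq2
    subst hb
    have hq1 := pu.of_append_left
    have ha := pv.of_append_left
    have hpath : (q1.append a.reverse).IsPath := by
      rw [SimpleGraph.Walk.isPath_def, SimpleGraph.Walk.support_append]
      have hnd := (SimpleGraph.Walk.isPath_def _).1 ha.reverse
      rw [← SimpleGraph.Walk.cons_tail_support, List.nodup_cons] at hnd
      refine List.Nodup.append ((SimpleGraph.Walk.isPath_def _).1 hq1) hnd.2 ?_
      intro x hx1 hx2
      have hxa : x ∈ a.support := by
        have := List.mem_of_mem_tail hx2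
        simpa using this
      have : x = w := hx x hx1 (by
        show x ∈ (pth v).support
        rw [e', SimpleGraph.Walk.mem_support_append_iff]
        exact Or.inl hxa)
      subst this
      exact hnd.1 hx2
    have hu : h u = walkWeight W.w q1 + h w := by
      simp only [hh]
      rw [e, walkWeight_append']
    have hv : h v = walkWeight W.w a + h w := by
      simp only [hh]
      rw [e', walkWeight_append']
    have n1 := walkWeight_nonneg' W q1
    have n2 := walkWeight_nonneg' W a
    refine ⟨w, ?_, by linarith, by linarith, ?_⟩
    · intro x
      simp only [List.mem_toFinset]
      constructor
      · intro hxw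
        rw [e, e']
        simp only [SimpleGraph.Walk.mem_support_append_iff]
        exact ⟨Or.inr hxw, Or.inr hxw⟩
      · rintro ⟨h1, h2⟩
        rw [e, SimpleGraph.Walk.mem_support_append_iff] at h1
        rcases h1 with h1 | h1
        · have := hx x h1 h2
          subst this
          simp
        · exact h1
    · rw [dist_eq_of_isPath W hT _ hpath, walkWeight_append', walkWeight_reverse' _ W.w_symm]
      linarith

/-- The embedding of a single tree metric. -/
lemma tree_embedding {X : Type} (ρ : X → X → ℝ) (hρ : IsTreeMetric ρ) (s : X → ℝ)
    (hs : ∀ v, 0 < s v) (hL : ∀ u v, |s v - s u| ≤ ρ v u) :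
    ∃ (K : Type) (_ : Fintype K) (F : X → K → ℝ),
      (∀ v, ∑ k, |F v k| = s v) ∧ (∀ u v, ∑ k, |F v k - F u k| ≤ 3 * ρ v u) ∧
      (∀ u v, min (ρ v u) (min (s v) (s u)) / 2 ≤ ∑ k, |F v k - F u k|) := by
  classical
  obtain ⟨V, hV, W, hT, j, -, hj⟩ := hρ
  obtain ⟨P, h, g, g0, gm, h0, hsum, hlca⟩ := tree_data W hT
  let T : X → ℝ := fun v => s v - h (j v)
  let F : X → V → ℝ := fun v x => if x ∈ P (j v) then g x (T v) else 0
  have hP : ∀ v, ∑ x ∈ P (j v), g x (T v) = s v := by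
    intro v
    rw [hsum]
    simp only [T]
    rw [sub_add_cancel, max_eq_left (hs v).le]
  have hF : ∀ u v, ∃ w, h w ≤ h (j u) ∧ h w ≤ h (j v) ∧
      ρ u v = h (j u) + h (j v) - 2 * h w ∧
      ∑ x, |F u x - F v x| = |max (T u + h w) 0 - max (T v + h w) 0|
        + (s u - max (T u + h w) 0) + (s v - max (T v + h w) 0) := by
    intro u v
    obtain ⟨w, hw, l1, l2, hd⟩ := hlca (j u) (j v)
    refine ⟨w, l1, l2, by rw [hj, hd], ?_⟩
    have hpt : ∀ x, |F u x - F v x| = (if x ∈ P w then |g x (T u) - g x (T v)| else 0)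
        + ((if x ∈ P (j u) then g x (T u) else 0) - (if x ∈ P w then g x (T u) else 0))
        + ((if x ∈ P (j v) then g x (T v) else 0) - (if x ∈ P w then g x (T v) else 0)) := by
      intro x
      have hx := hw x
      have a1 := g0 x (T u)
      have a2 := g0 x (T v)
      by_cases b1 : x ∈ P (j u) <;> by_cases b2 : x ∈ P (j v) <;>
        simp [F, hx, b1, b2, abs_of_nonneg, a1, a2]
    have habs : ∑ x ∈ P w, |g x (T u) - g x (T v)|
        = |max (T u + h w) 0 - max (T v + h w) 0| := by
      rw [← hsum, ← hsum, ← Finset.sum_sub_distrib]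
      rcases le_total (T u) (T v) with hle | hle
      · rw [abs_of_nonpos (Finset.sum_nonpos fun x _ => sub_nonpos.2 (gm x hle)),
          ← Finset.sum_neg_distrib]
        exact Finset.sum_congr rfl fun x _ => abs_of_nonpos (sub_nonpos.2 (gm x hle))
      · rw [abs_of_nonneg (Finset.sum_nonneg fun x _ => sub_nonneg.2 (gm x hle))]
        exact Finset.sum_congr rfl fun x _ => abs_of_nonneg (sub_nonneg.2 (gm x hle))
    rw [Finset.sum_congr rfl fun x _ => hpt x]
    simp only [Finset.sum_add_distrib, Finset.sum_sub_distrib, Finset.sum_ite_mem,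
      Finset.univ_inter]
    rw [habs, hP, hP, hsum, hsum]
  refine ⟨V, hV, F, ?_, ?_, ?_⟩
  · intro v
    rw [← hP v]
    have : ∀ x, |F v x| = if x ∈ P (j v) then g x (T v) else 0 := by
      intro x
      by_cases b : x ∈ P (j v) <;> simp [F, b, abs_of_nonneg, g0]
    rw [Finset.sum_congr rfl fun x _ => this x]
    simp only [Finset.sum_ite_mem, Finset.univ_inter]
  · intro u v
    obtain ⟨w, l1, l2, hd, he⟩ := hF v u
    rw [he]
    have e1 := abs_max_sub_max_le_abs (T v + h w) (T u + h w) 0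
    have e2 := le_max_left (T v + h w) 0
    have e3 := le_max_left (T u + h w) 0
    have e4 : |T v + h w - (T u + h w)| ≤ |s v - s u| + |h (j v) - h (j u)| := by
      have : T v + h w - (T u + h w) = (s v - s u) - (h (j v) - h (j u)) := by
        simp only [T]; ring
      rw [this]
      exact abs_sub _ _
    have e5 : |h (j v) - h (j u)| ≤ ρ v u := by
      rw [abs_le]
      constructor <;> linarith
    have e6 := hL u v
    simp only [T] at *
    linarith
  · intro u v
    obtain ⟨w, l1, l2, hd, he⟩ := hF v u
    rw [he]
    have e1 := abs_nonneg (max (T v + h w) 0 - max (T u + h w) 0)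
    have e2 : min (h (j v) - h w) (s v) ≤ s v - max (T v + h w) 0 := by
      simp only [T]
      rcases max_cases (s v - h (j v) + h w) 0 with ⟨e, _⟩ | ⟨e, _⟩ <;> rw [e]
      · exact (min_le_left _ _).trans (by linarith)
      · exact (min_le_right _ _).trans (by linarith)
    have e3 : min (h (j u) - h w) (s u) ≤ s u - max (T u + h w) 0 := by
      simp only [T]
      rcases max_cases (s u - h (j u) + h w) 0 with ⟨e, _⟩ | ⟨e, _⟩ <;> rw [e]
      · exact (min_le_left _ _).trans (by linarith)
      · exact (min_le_right _ _).trans (by linarith)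
    have sv := hs v
    have su := hs u
    have m1 := min_le_left (ρ v u) (min (s v) (s u))
    have m2 := (min_le_right (ρ v u) (min (s v) (s u))).trans (min_le_left _ _)
    have m3 := (min_le_right (ρ v u) (min (s v) (s u))).trans (min_le_right _ _)
    rcases min_cases (h (j v) - h w) (s v) with ⟨f1, _⟩ | ⟨f1, _⟩ <;>
    rcases min_cases (h (j u) - h w) (s u) with ⟨f2, _⟩ | ⟨f2, _⟩ <;>
    rw [f1] at e2 <;> rw [f2] at e3 <;> linarith

/-- Finite-dimensional `ℓ₁` spaces embed in `ℓ1`. -/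
lemma exists_l1_embedding (K : Type) [Fintype K] :
    ∃ Φ : (K → ℝ) → ℓ1, (∀ x y, Φ x - Φ y = Φ (x - y)) ∧ ∀ x, ‖Φ x‖ = ∑ k, |x k| := by
  classical
  let e : K → ℕ := fun k => (Fintype.equivFin K k : ℕ)
  have he : Function.Injective e := fun a b hab =>
    (Fintype.equivFin K).injective (Fin.ext hab)
  have hsum : ∀ x : K → ℝ,
      HasSum (fun n => ‖Function.extend e x 0 n‖) (∑ k, |x k|) := by
    intro x
    have h1 : (fun n => ‖Function.extend e x 0 n‖)
        = Function.extend e (fun k => |x k|) 0 := by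
      funext n
      by_cases hn : ∃ k, e k = n
      · obtain ⟨k, rfl⟩ := hn
        rw [he.extend_apply, he.extend_apply, Real.norm_eq_abs]
      · rw [Function.extend_apply' _ _ _ hn, Function.extend_apply' _ _ _ hn]
        simp
    rw [h1, hasSum_extend_zero he]
    exact hasSum_fintype _
  have hmem : ∀ x : K → ℝ, Memℓp (E := fun _ : ℕ => ℝ) (Function.extend e x 0) 1 := by
    intro x
    apply memℓp_gen
    simpa using (hsum x).summable
  refine ⟨fun x => ⟨Function.extend e x 0, hmem x⟩, ?_, ?_⟩
  · intro x y
    apply Subtype.ext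
    funext n
    show Function.extend e x 0 n - Function.extend e y 0 n = Function.extend e (x - y) 0 n
    by_cases hn : ∃ k, e k = n
    · obtain ⟨k, rfl⟩ := hn
      simp only [he.extend_apply, Pi.sub_apply]
    · simp only [Function.extend_apply' _ _ _ hn]
      simp
  · intro x
    rw [lp.norm_eq_tsum_rpow (by simp)]
    simpa using (hsum x).tsum_eq

/-- There is a universal constant `C > 0` such that the following holds.  Let `(X,d)` be
a finite metric space admitting a dominating stochastic embedding into tree metrics with
expected distortion `D ≥ 1` (a finitely supported distribution, index type `ι` with
probabilities `p`, over dominating tree metrics `ρ i` with `E[ρ(u,v)] ≤ D·d(u,v)`), and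
let `s : X → ℝ` be positive and `1`-Lipschitz.  Then there is `f : X → ℓ₁` with
`‖f v‖ = s v` for every `v`, which is `C·D`-Lipschitz, and such that for every `c ≥ 1`
and every pair `u, v` with `min {s v, s u} ≥ d(u,v)/c` one has
`‖f v - f u‖ ≥ d(v,u)/(12c)`. -/
theorem nonuniform_truncated_embedding_of_tree_embedding :
    ∃ C : ℝ, 0 < C ∧
      ∀ (X : Type) (_ : Fintype X) (_ : MetricSpace X) (D : ℝ), 1 ≤ D →
      ∀ (ι : Type) (_ : Fintype ι) (p : ι → ℝ) (ρ : ι → X → X → ℝ),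
        (∀ i, 0 ≤ p i) → (∑ i, p i = 1) →
        (∀ i, p i ≠ 0 → IsTreeMetric (ρ i)) →
        (∀ i, p i ≠ 0 → ∀ u v : X, dist u v ≤ ρ i u v) →
        (∀ u v : X, ∑ i, p i * ρ i u v ≤ D * dist u v) →
      ∀ s : X → ℝ, (∀ v : X, 0 < s v) → (∀ u v : X, |s v - s u| ≤ dist v u) →
        ∃ f : X → ℓ1,
          (∀ v : X, ‖f v‖ = s v) ∧
          (∀ u v : X, ‖f v - f u‖ ≤ C * D * dist v u) ∧
          (∀ c : ℝ, 1 ≤ c → ∀ u v : X, dist u v / c ≤ min (s v) (s u) →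
            dist v u / (12 * c) ≤ ‖f v - f u‖) := by
  classical
  refine ⟨3, by norm_num, ?_⟩
  intro X _ _ D hD ι _ p ρ hp0 hp1 htree hdom hexp s hs hL
  have hex : ∀ i, ∃ (K : Type) (_ : Fintype K) (F : X → K → ℝ), p i ≠ 0 →
      ((∀ v, ∑ k, |F v k| = s v) ∧ (∀ u v, ∑ k, |F v k - F u k| ≤ 3 * ρ i v u) ∧
      (∀ u v, min (ρ i v u) (min (s v) (s u)) / 2 ≤ ∑ k, |F v k - F u k|)) := by
    intro i
    by_cases hi : p i = 0
    · exact ⟨Unit, inferInstance, fun _ _ => 0, fun h => absurd hi h⟩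
    · obtain ⟨K, hK, F, hF⟩ := tree_embedding (ρ i) (htree i hi) s hs
        (fun u v => (hL u v).trans (hdom i hi v u))
      exact ⟨K, hK, F, fun _ => hF⟩
  choose K hK F hF using hex
  obtain ⟨Φ, hΦ, hn⟩ := exists_l1_embedding (Σ i, K i)
  have hd : ∀ u v, ‖Φ (fun k => p k.1 * F k.1 v k.2) - Φ (fun k => p k.1 * F k.1 u k.2)‖
      = ∑ i, p i * ∑ k, |F i v k - F i u k| := by
    intro u v
    rw [hΦ, hn, Fintype.sum_sigma]
    refine Finset.sum_congr rfl fun i _ => ?_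
    rw [Finset.mul_sum]
    refine Finset.sum_congr rfl fun k _ => ?_
    simp only [Pi.sub_apply]
    rw [← mul_sub, abs_mul, abs_of_nonneg (hp0 i)]
  refine ⟨fun v => Φ (fun k => p k.1 * F k.1 v k.2), ?_, ?_, ?_⟩
  · intro v
    rw [hn, Fintype.sum_sigma]
    have : ∀ i, ∑ k, |p i * F i v k| = p i * s v := by
      intro i
      by_cases hi : p i = 0
      · simp [hi]
      · rw [← (hF i hi).1 v, Finset.mul_sum]
        refine Finset.sum_congr rfl fun k _ => ?_
        rw [abs_mul, abs_of_nonneg (hp0 i)]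
    rw [Finset.sum_congr rfl fun i _ => this i, ← Finset.sum_mul, hp1, one_mul]
  · intro u v
    rw [hd]
    calc ∑ i, p i * ∑ k, |F i v k - F i u k| ≤ ∑ i, 3 * (p i * ρ i v u) := by
          refine Finset.sum_le_sum fun i _ => ?_
          by_cases hi : p i = 0
          · simp [hi]
          · have := mul_le_mul_of_nonneg_left ((hF i hi).2.1 u v) (hp0 i)
            linarith
      _ = 3 * ∑ i, p i * ρ i v u := by rw [Finset.mul_sum]
      _ ≤ 3 * D * dist v u := by
          have := hexp v u
          linarith
  · intro c hc u v hm
    rw [hd]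
    have hc0 : 0 < c := by linarith
    have hdn : 0 ≤ dist v u := dist_nonneg
    rw [dist_comm] at hm
    calc dist v u / (12 * c) = ∑ i, p i * (dist v u / (12 * c)) := by
          rw [← Finset.sum_mul, hp1, one_mul]
      _ ≤ ∑ i, p i * ∑ k, |F i v k - F i u k| := by
          refine Finset.sum_le_sum fun i _ => ?_
          by_cases hi : p i = 0
          · simp [hi]
          · refine mul_le_mul_of_nonneg_left ?_ (hp0 i)
            refine le_trans ?_ ((hF i hi).2.2 u v)
            have h1 : dist v u / c ≤ min (ρ i v u) (min (s v) (s u)) :=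
              le_min ((div_le_self hdn hc).trans (hdom i hi v u)) hm
            have h2 : dist v u / (12 * c) = dist v u / c / 12 := by
              rw [div_div, mul_comm]
            have h3 : 0 ≤ dist v u / c := by positivity
            rw [h2]
            linarith
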